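/- In the ring of formal power series over ℚ in the three variables x, v, w, let f = Σ_{n ≥ 1} Σ_{m=0}^{n−1} Σ_{r=0}^{m} c(n,m,r)·x^n·v^r·w^m, where c(n,m,r) is the number of ascent sequences of length n avoiding the pattern 021 that have exactly m ascents and largest letter r, and let h = Σ_{n ≥ 1} Σ_{m=0}^{n−1} N_{n,m+1}·x^n·(vw)^m, where N_{n,m} = (1/n)·binom(n,m)·binom(n,m−1) are the Narayana numbers. Then (1−x)·((1−v)·((1−x)² − w·x²) − v·w·x)·f = x·(1−v)·((1−x)² − w·x²) − v²·w·x·(1−x)·h. -/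

import Mathlib

/-- The number of ascents of a word of nonnegative integers. -/
def numAscents (w : List ℕ) : ℕ :=
  (w.zip w.tail).countP (fun p => p.1 < p.2)

/-- A word of nonnegative integers is an ascent sequence if it starts with 0 and
each subsequent entry is at most one more than the number of ascents preceding it. -/
def IsAscentSeq (w : List ℕ) : Prop :=
  w.head? = some 0 ∧
    ∀ i (h : i < w.length), 1 ≤ i → w.get ⟨i, h⟩ ≤ numAscents (w.take i) + 1

/-- A word `π` contains the pattern `τ` if it has a subsequence order-isomorphic to `τ`. -/
def Contains (π τ : List ℕ) : Prop :=
  ∃ f : Fin τ.length → Fin π.length, StrictMono f ∧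
    ∀ i j, (π.get (f i) < π.get (f j) ↔ τ.get i < τ.get j) ∧
      (π.get (f i) > π.get (f j) ↔ τ.get i > τ.get j)

/-- A word avoids a pattern if it does not contain it. -/
def Avoids (π τ : List ℕ) : Prop := ¬ Contains π τ

/-- `c(n,m,r)`: the number of ascent sequences of length `n` avoiding the pattern 021
with exactly `m` ascents and largest letter `r`. -/
noncomputable def cCount (n m r : ℕ) : ℕ :=
  {w : List ℕ | w.length = n ∧ IsAscentSeq w ∧ Avoids w [0,2,1] ∧
    numAscents w = m ∧ w.foldr max 0 = r}.ncard

/-- The generating function `f = Σ_{n≥1} Σ_{m=0}^{n-1} Σ_{r=0}^{m} c(n,m,r) x^n v^r w^m`,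
as a formal power series in the variables `x, v, w` (indexed `0, 1, 2`). -/
noncomputable def fSeries : MvPowerSeries (Fin 3) ℚ :=
  fun d => if 1 ≤ d 0 ∧ d 2 < d 0 ∧ d 1 ≤ d 2 then (cCount (d 0) (d 2) (d 1) : ℚ) else 0

/-- The Narayana generating function
`h = Σ_{n≥1} Σ_{m=0}^{n-1} N_{n,m+1} x^n (vw)^m` with `N_{n,m} = (1/n) C(n,m) C(n,m-1)`. -/
noncomputable def hSeries : MvPowerSeries (Fin 3) ℚ :=
  fun d => if 1 ≤ d 0 ∧ d 2 < d 0 ∧ d 1 = d 2 then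
    ((d 0).choose (d 2 + 1) * (d 0).choose (d 2) : ℚ) / (d 0) else 0

/-- `C(n, m+1) C(n, m) / n`, the Narayana number `N_{n,m+1}`. -/
def narayana (n m : ℕ) : ℚ := (n.choose (m + 1) * n.choose m : ℚ) / n

theorem narayana_eq_zero {n m : ℕ} (h : n ≤ m) : narayana n m = 0 := by
  simp [narayana, Nat.choose_eq_zero_of_lt (Nat.lt_succ_of_le h)]

theorem mul_narayana (n m : ℕ) : (n : ℚ) * narayana n m = n.choose (m + 1) * n.choose m := by
  rcases Nat.eq_zero_or_pos n with rfl | hn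
  · simp [narayana]
  · rw [narayana]
    field_simp

theorem narayana_succ_zero (n : ℕ) : narayana (n + 1) 0 = 1 := by
  rw [narayana]
  push_cast [Nat.choose_one_right, Nat.choose_zero_right]
  field_simp

theorem narayana_succ_one (n : ℕ) : narayana (n + 1) 1 = (n + 1) * n / 2 := by
  rw [narayana, Nat.choose_one_right, Nat.cast_choose_two]
  push_cast
  field_simp
  ring

theorem cast_choose_succ (n k : ℕ) :
    (n.choose (k + 1) : ℚ) = n.choose k * (n - k) / (k + 1) := by
  rw [eq_div_iff (by positivity)]
  rcases le_or_gt k n with h | h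
  · have := Nat.choose_succ_right_eq n k
    rw [← Nat.cast_sub h]
    exact_mod_cast this
  · simp [Nat.choose_eq_zero_of_lt h, Nat.choose_eq_zero_of_lt (Nat.lt_succ_of_lt h)]

theorem narayana_recurrence (n m : ℕ) :
    (n + 3 : ℚ) * narayana (n + 2) (m + 2) =
      (2 * n + 3) * (narayana (n + 1) (m + 2) + narayana (n + 1) (m + 1)) -
        n * (narayana n (m + 2) - 2 * narayana n (m + 1) + narayana n m) := by
  have e : (n : ℚ) * (narayana n (m + 2) - 2 * narayana n (m + 1) + narayana n m) =
      n.choose (m + 3) * n.choose (m + 2) - 2 * (n.choose (m + 2) * n.choose (m + 1)) +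
        n.choose (m + 1) * n.choose m := by
    rw [← mul_narayana, ← mul_narayana n (m + 1), ← mul_narayana n m]
    ring
  rw [e]
  simp only [narayana, Nat.choose_succ_succ' (n + 1), Nat.choose_succ_succ' n]
  push_cast
  simp only [show m + 1 + 1 = m + 2 from rfl, show m + 2 + 1 = m + 3 from rfl]
  rw [cast_choose_succ n (m + 2), cast_choose_succ n (m + 1), cast_choose_succ n m]
  push_cast
  field_simp
  ring

theorem narayana_recurrence_zero (n : ℕ) :
    (n + 3 : ℚ) * narayana (n + 2) 0 =
      (2 * n + 3) * narayana (n + 1) 0 - n * narayana n 0 := by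
  rw [mul_narayana, narayana_succ_zero, narayana_succ_zero]
  simp
  ring

theorem narayana_recurrence_one (n : ℕ) :
    (n + 3 : ℚ) * narayana (n + 2) 1 =
      (2 * n + 3) * (narayana (n + 1) 1 + narayana (n + 1) 0) -
        n * (narayana n 1 - 2 * narayana n 0) := by
  have e : (n : ℚ) * (narayana n 1 - 2 * narayana n 0) =
      n.choose 2 * n - 2 * n := by
    rw [mul_sub, mul_narayana, mul_left_comm, mul_narayana]
    simp
  rw [e, narayana_succ_zero, narayana_succ_one, narayana_succ_one, Nat.cast_choose_two]
  push_cast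
  ring

/-- The polynomial `Σ_m N_{n,m+1} t^m`. -/
noncomputable def narayanaPoly (n : ℕ) : Polynomial ℚ :=
  ∑ m ∈ Finset.range n, Polynomial.monomial m (narayana n m)

theorem coeff_narayanaPoly (n m : ℕ) : (narayanaPoly n).coeff m = narayana n m := by
  simp only [narayanaPoly, Polynomial.finsetSum_coeff, Polynomial.coeff_monomial,
    Finset.sum_ite_eq', Finset.mem_range]
  split_ifs with h
  · rfl
  · exact (narayana_eq_zero (not_lt.mp h)).symm

theorem narayanaPoly_zero : narayanaPoly 0 = 0 := by simp [narayanaPoly]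

theorem narayanaPoly_one : narayanaPoly 1 = 1 := by
  simp [narayanaPoly, narayana]

theorem narayanaPoly_recurrence (n : ℕ) :
    (n + 3 : Polynomial ℚ) * narayanaPoly (n + 2) =
      (2 * (n : Polynomial ℚ) + 3) * ((1 + Polynomial.X) * narayanaPoly (n + 1)) -
        (n : Polynomial ℚ) * ((1 - Polynomial.X) ^ 2 * narayanaPoly n) := by
  have two : Polynomial.C (2 : ℚ) = 2 := rfl
  have three : Polynomial.C (3 : ℚ) = 3 := rfl
  have c1 : (n + 3 : Polynomial ℚ) = Polynomial.C (n + 3 : ℚ) := by simp [three]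
  have c2 : (2 * n + 3 : Polynomial ℚ) = Polynomial.C (2 * n + 3 : ℚ) := by simp [two, three]
  have c3 : (n : Polynomial ℚ) = Polynomial.C (n : ℚ) := by simp
  have e : (1 - Polynomial.X) ^ 2 * narayanaPoly n = narayanaPoly n
      - Polynomial.C 2 * (Polynomial.X * narayanaPoly n)
      + Polynomial.X * (Polynomial.X * narayanaPoly n) := by
    rw [two]
    ring
  rw [c1, c2, c3, e, add_mul, one_mul]
  ext m
  rcases m with _ | _ | m
  · simp only [Polynomial.coeff_sub, Polynomial.coeff_add, Polynomial.coeff_C_mul,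
      Polynomial.coeff_X_mul_zero, coeff_narayanaPoly]
    linarith [narayana_recurrence_zero n]
  · simp only [Polynomial.coeff_sub, Polynomial.coeff_add, Polynomial.coeff_C_mul,
      Polynomial.coeff_X_mul_zero, Polynomial.coeff_X_mul, coeff_narayanaPoly]
    linarith [narayana_recurrence_one n]
  · simp only [Polynomial.coeff_sub, Polynomial.coeff_add, Polynomial.coeff_C_mul,
      Polynomial.coeff_X_mul, coeff_narayanaPoly]
    linarith [narayana_recurrence n m]

open PowerSeries in
/-- The Narayana generating function as a power series over `ℚ[t]`. -/
noncomputable def narayanaSeries : (Polynomial ℚ)⟦X⟧ := mk narayanaPoly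

open PowerSeries in
theorem narayanaSeries_ode :
    letI t : (Polynomial ℚ)⟦X⟧ := C Polynomial.X
    letI h := narayanaSeries
    (1 - 2 * (1 + t) * X + (1 - t) ^ 2 * X ^ 2) * (h + X * d⁄dX (Polynomial ℚ) h) =
      X * (-(1 + t) + (1 - t) ^ 2 * X) * h + 2 * X := by
  set t : (Polynomial ℚ)⟦X⟧ := C Polynomial.X with ht
  set h := narayanaSeries with hh
  have ha : C (1 + Polynomial.X) = 1 + t := by simp [ht]
  have hb : C ((1 - Polynomial.X) ^ 2) = (1 - t) ^ 2 := by simp [ht]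
  have hcoeff (n : ℕ) : coeff n h = narayanaPoly n := by simp [hh, narayanaSeries]
  have hy (n : ℕ) : coeff n (h + X * d⁄dX (Polynomial ℚ) h) = (n + 1) * narayanaPoly n := by
    rcases n with _ | n
    · simp [narayanaPoly_zero, hh, narayanaSeries]
    · simp only [map_add, coeff_succ_X_mul, coeff_derivative, hcoeff]
      push_cast
      ring
  generalize h + X * d⁄dX (Polynomial ℚ) h = y at hy ⊢
  suffices y + C ((1 - Polynomial.X) ^ 2) * (X * (X * y)) + C (1 + Polynomial.X) * (X * h) =
      C (1 + Polynomial.X) * (X * y) + C (1 + Polynomial.X) * (X * y)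
        + C ((1 - Polynomial.X) ^ 2) * (X * (X * h)) + (X + X) by
    rw [ha, hb] at this
    linear_combination this
  have hrec := narayanaPoly_recurrence
  generalize (1 + Polynomial.X : Polynomial ℚ) = a at hrec ⊢
  generalize (1 - Polynomial.X : Polynomial ℚ) ^ 2 = b at hrec ⊢
  ext1 n
  rcases n with _ | _ | n
  · simp only [map_add, coeff_C_mul, coeff_zero_X_mul, coeff_zero_X, hy, narayanaPoly_zero]
    simp
  · simp only [map_add, coeff_C_mul, coeff_succ_X_mul, coeff_zero_X_mul, hy, hcoeff, zero_add,
      narayanaPoly_zero, narayanaPoly_one, coeff_one_X]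
    simp
  · simp only [map_add, coeff_C_mul, coeff_succ_X_mul, hy, hcoeff, coeff_X]
    push_cast
    simp
    linear_combination hrec n

open PowerSeries in
/-- A power series that vanishes at the origin and satisfies the same first-order linear
equation as an invertible one is zero. -/
theorem PowerSeries.eq_zero_of_mul_derivative_eq {A : Type*} [CommRing A] [IsDomain A]
    [CharZero A] {D q : A⟦X⟧} (hD : IsUnit D) (hq : constantCoeff q = 0)
    (h : D * d⁄dX A q = d⁄dX A D * q) : q = 0 := by
  obtain ⟨I, hI⟩ := hD.exists_right_inv
  have h1 : D * d⁄dX A I + I * d⁄dX A D = 0 := by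
    have := congrArg (d⁄dX A) hI
    rw [Derivation.leibniz, derivative_one] at this
    simpa using this
  have h2 : d⁄dX A (q * I) = 0 := by
    rw [Derivation.leibniz, smul_eq_mul, smul_eq_mul]
    refine (hD.mul_right_eq_zero).mp ?_
    linear_combination I * h + q * h1
  have h3 : q * I = 0 := by
    refine derivative.ext (by rw [h2, map_zero]) ?_
    rw [map_mul, hq, zero_mul, map_zero]
  calc q = q * I * D := by rw [mul_assoc, mul_comm I, hI, mul_one]
    _ = 0 := by rw [h3, zero_mul]

open PowerSeries in
theorem narayanaSeries_quadratic :
    narayanaSeries = X * (1 + narayanaSeries) * (1 + C Polynomial.X * narayanaSeries) := by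
  have ode := narayanaSeries_ode
  set h := narayanaSeries
  set t : (Polynomial ℚ)⟦X⟧ := C Polynomial.X with ht
  have dt : d⁄dX (Polynomial ℚ) t = 0 := by rw [ht, derivative_C]
  have d2 : d⁄dX (Polynomial ℚ) (2 : (Polynomial ℚ)⟦X⟧) = 0 := by
    rw [show (2 : (Polynomial ℚ)⟦X⟧) = C 2 from (map_ofNat C 2).symm, derivative_C]
  have key : X * (h - X * (1 + h) * (1 + t * h)) = 0 := by
    refine PowerSeries.eq_zero_of_mul_derivative_eq
      (D := 1 - 2 * (1 + t) * X + (1 - t) ^ 2 * X ^ 2) ?_ ?_ ?_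
    · rw [isUnit_iff_constantCoeff]
      simp
    · simp
    · simp only [Derivation.leibniz, map_add, map_sub, derivative_one, derivative_X, dt, d2,
        smul_eq_mul, pow_two]
      linear_combination (1 - X * (1 + t) - 2 * X * t * h) * ode
  rcases mul_eq_zero.mp key with h0 | h0
  · exact absurd h0 X_ne_zero
  · exact sub_eq_zero.mp h0

/-- The largest letter of a word (0 for the empty word). -/
def maxLetter (w : List ℕ) : ℕ := w.foldr max 0

theorem maxLetter_append (u : List ℕ) (a : ℕ) : maxLetter (u ++ [a]) = max (maxLetter u) a := by
  induction u with
  | nil => simp [maxLetter]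
  | cons x u ih =>
    simp only [maxLetter, List.cons_append, List.foldr_cons] at ih ⊢
    rw [ih, max_assoc]

theorem maxLetter_le_iff {u : List ℕ} {a : ℕ} : maxLetter u ≤ a ↔ ∀ x ∈ u, x ≤ a := by
  induction u with
  | nil => simp [maxLetter]
  | cons x u ih =>
    simp only [maxLetter, List.foldr_cons, List.forall_mem_cons] at ih ⊢
    rw [max_le_iff, ih]

theorem numAscents_cons_cons (x y : ℕ) (u : List ℕ) :
    numAscents (x :: y :: u) = numAscents (y :: u) + if x < y then 1 else 0 := by
  simp [numAscents, List.countP_cons]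

theorem numAscents_append {u : List ℕ} (hu : u ≠ []) (a : ℕ) :
    numAscents (u ++ [a]) = numAscents u + if u.getLastD 0 < a then 1 else 0 := by
  induction u with
  | nil => exact absurd rfl hu
  | cons x u ih =>
    rcases u with _ | ⟨y, u⟩
    · simp [numAscents, List.countP_cons]
    · have := ih (by simp)
      simp only [List.cons_append] at this ⊢
      rw [numAscents_cons_cons, this, numAscents_cons_cons]
      simp only [List.getLastD_cons]
      omega

theorem isAscentSeq_append {u : List ℕ} (hu : u ≠ []) (a : ℕ) :
    IsAscentSeq (u ++ [a]) ↔ IsAscentSeq u ∧ a ≤ numAscents u + 1 := by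
  have hpos : 1 ≤ u.length := List.length_pos_of_ne_nil hu
  unfold IsAscentSeq
  rw [List.head?_append_of_ne_nil _ hu, and_assoc]
  refine and_congr_right fun _ => ?_
  simp only [List.get_eq_getElem, List.length_append, List.length_singleton]
  constructor
  · refine fun h => ⟨fun i hi h1 => ?_, ?_⟩
    · have := h i (by omega) h1
      rwa [List.getElem_append_left hi, List.take_append_of_le_length hi.le] at this
    · simpa using h u.length (by omega) hpos
  · rintro ⟨h, ha⟩ i hi h1
    rcases (Nat.lt_succ_iff_lt_or_eq.mp hi) with hi | rfl
    · rw [List.getElem_append_left hi, List.take_append_of_le_length hi.le]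
      exact h i hi h1
    · simpa using ha

/-- An ascent sequence avoids 021 exactly when its nonzero letters are weakly increasing. -/
theorem IsAscentSeq.avoids_iff {w : List ℕ} (hw : IsAscentSeq w) :
    Avoids w [0, 2, 1] ↔ w.Pairwise fun x y => y = 0 ∨ x ≤ y := by
  rw [List.pairwise_iff_getElem]
  constructor
  · intro h i j hi hj hij
    by_contra! hc
    obtain ⟨hne, hlt⟩ := hc
    have h0 : w[0] = 0 := by
      have := hw.1
      rw [List.head?_eq_getElem?, List.getElem?_eq_getElem (by omega)] at this
      exact Option.some.inj this
    have hi0 : 0 < i := by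
      rcases Nat.eq_zero_or_pos i with rfl | hi0
      · omega
      · exact hi0
    refine h ⟨![⟨0, by omega⟩, ⟨i, hi⟩, ⟨j, hj⟩], ?_, ?_⟩
    · refine Fin.strictMono_iff_lt_succ.mpr fun k => ?_
      fin_cases k
      · exact hi0
      · exact hij
    · intro a b
      fin_cases a <;> fin_cases b <;> simp [h0] <;> omega
  · rintro h ⟨f, hf, hord⟩
    have h12 : f 1 < f 2 := hf (by decide)
    have := h (f 1) (f 2) (f 1).2 (f 2).2 h12
    have h1 := (hord 0 2).1.mpr (by decide)
    have h2 := (hord 2 1).1.mpr (by decide)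
    simp only [List.get_eq_getElem] at h1 h2
    change w[(f 2 : ℕ)] < w[(f 1 : ℕ)] at h2
    change w[(f 0 : ℕ)] < w[(f 2 : ℕ)] at h1
    omega

/-- The 021-avoiding ascent sequences of length `n`, built letter by letter. -/
def words : ℕ → Finset (List ℕ)
  | 0 => ∅
  | 1 => {[0]}
  | n + 2 => ((words (n + 1)).sigma fun u =>
      insert 0 (Finset.Icc (max (maxLetter u) 1) (numAscents u + 1))).image fun p => p.1 ++ [p.2]

theorem sum_words_succ {M : Type*} [AddCommMonoid M] (n : ℕ) (g : List ℕ → M) :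
    ∑ w ∈ words (n + 2), g w = ∑ u ∈ words (n + 1), (g (u ++ [0]) +
      ∑ a ∈ Finset.Icc (max (maxLetter u) 1) (numAscents u + 1), g (u ++ [a])) := by
  rw [words, Finset.sum_image, Finset.sum_sigma]
  · refine Finset.sum_congr rfl fun u _ => Finset.sum_insert ?_
    simp
  · rintro ⟨u, a⟩ _ ⟨u', a'⟩ _ h
    obtain ⟨rfl, h⟩ := List.append_inj' h rfl
    simp_all

theorem mem_words {n : ℕ} {w : List ℕ} :
    w ∈ words n ↔ w.length = n ∧ IsAscentSeq w ∧ w.Pairwise fun x y => y = 0 ∨ x ≤ y := by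
  induction n using words.induct generalizing w with
  | case1 =>
    simp only [words, Finset.notMem_empty, false_iff, not_and, List.length_eq_zero_iff]
    rintro rfl h
    simp [IsAscentSeq] at h
  | case2 =>
    simp only [words, Finset.mem_singleton]
    constructor
    · rintro rfl
      refine ⟨rfl, ⟨rfl, fun i h h1 => ?_⟩, List.pairwise_singleton _ _⟩
      simp at h
      omega
    · rintro ⟨hl, h, _⟩
      obtain ⟨a, rfl⟩ := List.length_eq_one_iff.mp hl
      simpa [IsAscentSeq] using h.1
  | case3 n ih =>
    simp only [words, Finset.mem_image, Finset.mem_sigma, Sigma.exists, ih, Finset.mem_insert,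
      Finset.mem_Icc, max_le_iff]
    constructor
    · rintro ⟨u, a, ⟨⟨hl, hasc, hp⟩, ha⟩, rfl⟩
      have hu : u ≠ [] := by rintro rfl; simp at hl
      refine ⟨by simp [hl], (isAscentSeq_append hu a).mpr ⟨hasc, by omega⟩, ?_⟩
      rw [List.pairwise_append]
      refine ⟨hp, List.pairwise_singleton _ _, fun x hx y hy => ?_⟩
      rw [List.mem_singleton.mp hy]
      rcases ha with rfl | ha
      · exact Or.inl rfl
      · exact Or.inr (maxLetter_le_iff.mp ha.1.1 x hx)
    · rintro ⟨hl, hasc, hp⟩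
      rcases List.eq_nil_or_concat w with rfl | ⟨u, a, rfl⟩
      · simp at hl
      rw [List.concat_eq_append] at *
      have hl' : u.length = n + 1 := by simpa using hl
      have hu : u ≠ [] := by rintro rfl; simp at hl'
      rw [isAscentSeq_append hu] at hasc
      rw [List.pairwise_append] at hp
      refine ⟨u, a, ⟨⟨hl', hasc.1, hp.1⟩, ?_⟩, rfl⟩
      rcases Nat.eq_zero_or_pos a with rfl | ha
      · exact Or.inl rfl
      · refine Or.inr ⟨⟨maxLetter_le_iff.mpr fun x hx => ?_, ha⟩, hasc.2⟩
        exact (hp.2.2 x hx a (List.mem_singleton_self a)).resolve_left ha.ne'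

theorem words_invariants {n : ℕ} {w : List ℕ} (hw : w ∈ words n) :
    w ≠ [] ∧ maxLetter w ≤ numAscents w ∧ numAscents w < n ∧
      (w.getLastD 0 = 0 ∨ w.getLastD 0 = maxLetter w) ∧ (maxLetter w = 0 → numAscents w = 0) := by
  induction n using words.induct generalizing w with
  | case1 => simp [words] at hw
  | case2 =>
    simp only [words, Finset.mem_singleton] at hw
    subst hw
    simp [maxLetter, numAscents]
  | case3 n ih =>
    simp only [words, Finset.mem_image, Finset.mem_sigma, Sigma.exists, Finset.mem_insert,
      Finset.mem_Icc, max_le_iff] at hw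
    obtain ⟨u, a, ⟨hu, ha⟩, rfl⟩ := hw
    obtain ⟨hne, h1, h2, h3, h4⟩ := ih hu
    rw [maxLetter_append, numAscents_append hne, List.getLastD_concat]
    refine ⟨by simp, ?_⟩
    split_ifs <;> omega

theorem cCount_eq_card (n m r : ℕ) :
    cCount n m r = ((words n).filter fun w => maxLetter w = r ∧ numAscents w = m).card := by
  rw [cCount, ← Set.ncard_coe_finset]
  congr 1
  ext w
  simp only [Set.mem_ofPred_eq, Finset.coe_filter, mem_words]
  constructor
  · rintro ⟨h1, h2, h3, h4, h5⟩
    exact ⟨⟨h1, h2, h2.avoids_iff.mp h3⟩, h5, h4⟩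
  · rintro ⟨⟨h1, h2, h3⟩, h5, h4⟩
    exact ⟨h1, h2, h2.avoids_iff.mpr h3, h4, h5⟩

open Polynomial in
/-- The weight `v ^ (largest letter) * w ^ (number of ascents)`, with `v = C X` and `w = X`. -/
noncomputable def wordWeight (u : List ℕ) : ℚ[X][X] := C X ^ maxLetter u * X ^ numAscents u

open Polynomial in
/-- The substitution `v ↦ 1`, `w ↦ v * w`. -/
noncomputable def diagHom : ℚ[X][X] →+* ℚ[X][X] :=
  eval₂RingHom (C.comp (C.comp (evalRingHom 1))) (C X * X)

open Polynomial in
theorem diagHom_C_X : diagHom (C X) = 1 := by simp [diagHom]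

open Polynomial in
theorem diagHom_X : diagHom X = C X * X := by simp [diagHom]

open Polynomial in
theorem diagHom_wordWeight (u : List ℕ) :
    diagHom (wordWeight u) = (C X * X) ^ numAscents u := by
  simp [wordWeight, diagHom_C_X, diagHom_X]

theorem one_sub_mul_sum_Icc_pow {A : Type*} [CommRing A] (v : A) {r s : ℕ} (h : r ≤ s + 1) :
    (1 - v) * ∑ a ∈ Finset.Icc r s, v ^ a = v ^ r - v ^ (s + 1) := by
  rw [← Finset.Ico_succ_right_eq_Icc, mul_comm]
  exact geom_sum_Ico_mul_neg v h

theorem wordWeight_append_zero {u : List ℕ} (hu : u ≠ []) :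
    wordWeight (u ++ [0]) = wordWeight u := by
  simp [wordWeight, maxLetter_append, numAscents_append hu]

open Polynomial in
/-- The generating polynomial of the words obtained by adding a nonzero letter to a word. -/
theorem one_sub_mul_sum_wordWeight_append {n : ℕ} {u : List ℕ} (hu : u ∈ words n) :
    (1 - C X) * ∑ a ∈ Finset.Icc (max (maxLetter u) 1) (numAscents u + 1), wordWeight (u ++ [a]) =
      (1 - C X) * (if u.getLastD 0 = 0 then 0 else wordWeight u) +
        X * (C X * (if u.getLastD 0 = 0 then 0 else wordWeight u) +
          (if u.getLastD 0 = 0 then wordWeight u else 0) - C X ^ 2 * diagHom (wordWeight u) -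
            (1 - C X) * (if maxLetter u = 0 then 1 else 0)) := by
  obtain ⟨hne, h1, h2, h3, h4⟩ := words_invariants hu
  have hbig (a : ℕ) (ha : maxLetter u ≤ a) (ha' : u.getLastD 0 < a) :
      wordWeight (u ++ [a]) = X ^ (numAscents u + 1) * C X ^ a := by
    rw [wordWeight, maxLetter_append, numAscents_append hne, if_pos ha', max_eq_right ha, mul_comm]
  rw [diagHom_wordWeight]
  by_cases hl : u.getLastD 0 = 0
  · rw [Finset.sum_congr rfl fun a ha => hbig a (by simp at ha; omega) (by simp at ha; omega),
      ← Finset.mul_sum, mul_left_comm, one_sub_mul_sum_Icc_pow _ (by omega)]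
    simp only [hl, if_true]
    by_cases hm : maxLetter u = 0
    · rw [wordWeight, h4 hm, hm]
      simp
    · rw [if_neg hm, max_eq_left (by omega), wordWeight]
      ring
  · have hlast := h3.resolve_left hl
    have hpos : 1 ≤ maxLetter u := by omega
    have hrep : wordWeight (u ++ [maxLetter u]) = wordWeight u := by
      rw [wordWeight, maxLetter_append, numAscents_append hne, hlast]
      simp [wordWeight]
    rw [max_eq_left hpos, ← Finset.add_sum_Ioc_eq_sum_Icc (by omega), hrep,
      Finset.sum_congr rfl fun a ha => hbig a (by simp at ha; omega) (by simp at ha; omega),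
      ← Finset.mul_sum, ← Finset.Icc_add_one_left_eq_Ioc, mul_add, mul_left_comm,
      one_sub_mul_sum_Icc_pow _ (by omega)]
    simp only [hl, if_false]
    rw [if_neg (by omega), wordWeight]
    ring

section

open PowerSeries

/-- The generating function of the avoiding words, weighted by a function of the word. -/
noncomputable def wordSeries (g : List ℕ → Polynomial (Polynomial ℚ)) :
    (Polynomial (Polynomial ℚ))⟦X⟧ :=
  mk fun n => ∑ u ∈ words n, g u

theorem wordSeries_add (g k : List ℕ → Polynomial (Polynomial ℚ)) :
    wordSeries (fun u => g u + k u) = wordSeries g + wordSeries k := by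
  ext1 n
  simp [wordSeries, Finset.sum_add_distrib]

theorem wordSeries_last_zero :
    wordSeries (fun u => if u.getLastD 0 = 0 then wordWeight u else 0) =
      X + X * wordSeries wordWeight := by
  ext1 n
  rcases n with _ | _ | n
  · simp [wordSeries, words]
  · simp [wordSeries, words, wordWeight, maxLetter, numAscents]
  · simp only [wordSeries, coeff_mk, map_add, coeff_succ_X_mul, sum_words_succ, coeff_X]
    rw [if_neg (by omega), zero_add]
    refine Finset.sum_congr rfl fun u hu => ?_
    rw [wordWeight_append_zero (words_invariants hu).1, Finset.sum_eq_zero]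
    · simp
    · intro a ha
      simp at ha ⊢
      omega

theorem wordSeries_all_zero :
    (1 - X) * wordSeries (fun u => if maxLetter u = 0 then 1 else 0) = X := by
  suffices wordSeries (fun u => if maxLetter u = 0 then 1 else 0) =
      X + X * wordSeries (fun u => if maxLetter u = 0 then 1 else 0) by
    linear_combination this
  ext1 n
  rcases n with _ | _ | n
  · simp [wordSeries, words]
  · simp [wordSeries, words, maxLetter]
  · simp only [wordSeries, coeff_mk, map_add, coeff_succ_X_mul, sum_words_succ, coeff_X]
    rw [if_neg (by omega), zero_add]
    refine Finset.sum_congr rfl fun u hu => ?_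
    rw [Finset.sum_eq_zero]
    · simp [maxLetter_append]
    · intro a ha
      simp [maxLetter_append] at ha ⊢
      omega

theorem wordSeries_last_ne_zero :
    letI v : (Polynomial (Polynomial ℚ))⟦X⟧ := C (Polynomial.C Polynomial.X)
    letI w : (Polynomial (Polynomial ℚ))⟦X⟧ := C Polynomial.X
    letI b := wordSeries (fun u => if u.getLastD 0 = 0 then 0 else wordWeight u)
    (1 - v) * b = X * ((1 - v) * b + w * (v * b +
      wordSeries (fun u => if u.getLastD 0 = 0 then wordWeight u else 0) -
      v ^ 2 * map diagHom (wordSeries wordWeight) -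
      (1 - v) * wordSeries (fun u => if maxLetter u = 0 then 1 else 0))) := by
  have e : (1 - C (Polynomial.C Polynomial.X) : (Polynomial (Polynomial ℚ))⟦X⟧) =
    C (1 - Polynomial.C Polynomial.X) := by simp
  rw [e, ← map_pow]
  ext1 n
  rcases n with _ | _ | n
  · simp [wordSeries, words]
  · simp only [coeff_succ_X_mul, map_add (coeff _), map_sub (coeff _), coeff_C_mul, coeff_map,
      wordSeries, coeff_mk]
    simp [words]
  · simp only [coeff_succ_X_mul, map_add (coeff _), map_sub (coeff _), coeff_C_mul, coeff_map,
      wordSeries, coeff_mk, sum_words_succ, map_sum, Finset.mul_sum,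
      ← Finset.sum_add_distrib, ← Finset.sum_sub_distrib]
    refine Finset.sum_congr rfl fun u hu => ?_
    rw [← one_sub_mul_sum_wordWeight_append hu]
    congr 1
    rw [wordWeight_append_zero (words_invariants hu).1]
    simp only [List.getLastD_concat, if_true, zero_add]
    refine Finset.sum_congr rfl fun a ha => if_neg ?_
    simp at ha
    omega

/-- The substitution `t ↦ v * w`. -/
noncomputable def prodHom : Polynomial ℚ →+* Polynomial (Polynomial ℚ) :=
  Polynomial.eval₂RingHom (Polynomial.C.comp Polynomial.C)
    (Polynomial.C Polynomial.X * Polynomial.X)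

theorem prodHom_X : prodHom Polynomial.X = Polynomial.C Polynomial.X * Polynomial.X := by
  simp [prodHom]

theorem diagHom_comp_prodHom : diagHom.comp prodHom = prodHom := by
  refine Polynomial.ringHom_ext (fun a => ?_) ?_
  · simp [prodHom, diagHom]
  · simp [prodHom, diagHom]

theorem map_diagHom_map_prodHom (p : (Polynomial ℚ)⟦X⟧) :
    map diagHom (map prodHom p) = map prodHom p := by
  ext1 n
  simp only [coeff_map]
  exact congrArg (fun k => k (coeff n p)) diagHom_comp_prodHom

/-- The homogeneous part of the functional equation has only the trivial solution. -/
theorem eq_zero_of_kernel_equation {d : (Polynomial (Polynomial ℚ))⟦X⟧}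
    (h : letI v : (Polynomial (Polynomial ℚ))⟦X⟧ := C (Polynomial.C Polynomial.X)
      letI w : (Polynomial (Polynomial ℚ))⟦X⟧ := C Polynomial.X
      ((1 - v) * ((1 - X) ^ 2 - w * X ^ 2) - v * w * X) * d =
        -(v ^ 2 * w * X * map diagHom d)) : d = 0 := by
  have hne : (1 - Polynomial.C Polynomial.X : Polynomial (Polynomial ℚ)) ≠ 0 := by
    rw [← Polynomial.C_1, ← Polynomial.C_sub, Ne, Polynomial.C_eq_zero]
    intro h0
    simpa using congrArg (Polynomial.eval 0) h0
  have e : (1 - C (Polynomial.C Polynomial.X) : (Polynomial (Polynomial ℚ))⟦X⟧) =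
    C (1 - Polynomial.C Polynomial.X) := by simp
  set v : (Polynomial (Polynomial ℚ))⟦X⟧ := C (Polynomial.C Polynomial.X)
  set w : (Polynomial (Polynomial ℚ))⟦X⟧ := C Polynomial.X
  obtain ⟨k, hk⟩ : ∃ k, C (1 - Polynomial.C Polynomial.X) * d =
      X * (k * d - v ^ 2 * w * map diagHom d) :=
    ⟨(1 - v) * (2 - X + w * X) + v * w, by rw [← e]; linear_combination h⟩
  ext1 n
  rw [map_zero]
  induction n using Nat.strong_induction_on with
  | _ n ih =>
    have hn := congrArg (coeff n) hk
    rw [coeff_C_mul] at hn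
    refine (mul_eq_zero.mp (hn.trans ?_)).resolve_left hne
    rcases n with _ | n
    · simp
    · rw [coeff_succ_X_mul, map_sub, coeff_mul, coeff_mul, Finset.sum_eq_zero, Finset.sum_eq_zero,
        sub_zero]
      · rintro ⟨i, j⟩ hij
        rw [coeff_map, ih j (by simp at hij; omega), map_zero, mul_zero]
      · rintro ⟨i, j⟩ hij
        rw [ih j (by simp at hij; omega), mul_zero]

/-- The functional equation in `ℚ[v][w]⟦x⟧`. -/
theorem wordSeries_functional_equation :
    letI v : (Polynomial (Polynomial ℚ))⟦X⟧ := C (Polynomial.C Polynomial.X)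
    letI w : (Polynomial (Polynomial ℚ))⟦X⟧ := C Polynomial.X
    (1 - X) * ((1 - v) * ((1 - X) ^ 2 - w * X ^ 2) - v * w * X) * wordSeries wordWeight =
      X * (1 - v) * ((1 - X) ^ 2 - w * X ^ 2) -
        v ^ 2 * w * X * (1 - X) * map prodHom narayanaSeries := by
  have hb := wordSeries_last_ne_zero
  have ha := wordSeries_last_zero
  have hz := wordSeries_all_zero
  have hab := wordSeries_add (fun u => if u.getLastD 0 = 0 then wordWeight u else 0)
    (fun u => if u.getLastD 0 = 0 then 0 else wordWeight u)
  rw [show (fun u : List ℕ => (if u.getLastD 0 = 0 then wordWeight u else 0) +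
    (if u.getLastD 0 = 0 then 0 else wordWeight u)) = wordWeight by
      funext u; split_ifs <;> simp] at hab
  have hq := congrArg (map prodHom) narayanaSeries_quadratic
  have hLh := map_diagHom_map_prodHom narayanaSeries
  simp only [map_mul, map_add, map_one, map_X, map_C, prodHom_X] at hq
  have hLv : map diagHom (C (Polynomial.C Polynomial.X)) = 1 := by
    rw [map_C, diagHom_C_X, map_one]
  have hLw : map diagHom (C Polynomial.X) =
      C (Polynomial.C Polynomial.X) * C Polynomial.X := by
    rw [map_C, diagHom_X, map_mul]
  set h := map prodHom narayanaSeries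
  set f := wordSeries wordWeight
  set v : (Polynomial (Polynomial ℚ))⟦X⟧ := C (Polynomial.C Polynomial.X)
  set w : (Polynomial (Polynomial ℚ))⟦X⟧ := C Polynomial.X
  set a := wordSeries (fun u => if u.getLastD 0 = 0 then wordWeight u else 0)
  set b := wordSeries (fun u => if u.getLastD 0 = 0 then 0 else wordWeight u)
  set z := wordSeries (fun u => if maxLetter u = 0 then 1 else 0)
  have hf : (1 - X) * ((1 - v) * ((1 - X) ^ 2 - w * X ^ 2) - v * w * X) * f =
      X * (1 - v) * ((1 - X) ^ 2 - w * X ^ 2) - v ^ 2 * w * X * (1 - X) * map diagHom f := by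
    have hb' : b = f - a := by rw [hab]; ring
    rw [hb', ha] at hb
    linear_combination (1 - X) * hb - w * X * (1 - v) * hz
  obtain ⟨I, hI⟩ : ∃ I, (1 - X) * (1 - X - w * X * h) * I = 1 := by
    refine IsUnit.exists_right_inv ?_
    rw [isUnit_iff_constantCoeff]
    simp
  obtain ⟨F, hF⟩ : ∃ F, (1 - X) * (1 - X - w * X * h) * F =
      X * (1 - X - w * X * h) + v * w * X * h :=
    ⟨I * (X * (1 - X - w * X * h) + v * w * X * h), by rw [← mul_assoc, hI, one_mul]⟩
  have ne_zero_of (p : (Polynomial (Polynomial ℚ))⟦X⟧) (hp : constantCoeff p = 1) : p ≠ 0 := by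
    rintro rfl
    simp at hp
  have hLF : map diagHom F = h := by
    have := congrArg (map diagHom) hF
    simp only [map_mul, map_add, map_sub, map_one, map_X, hLv, hLw, hLh] at this
    refine mul_left_cancel₀ (ne_zero_of ((1 - X) * (1 - X - v * w * X * h)) (by simp)) ?_
    linear_combination this - (1 - X) * hq
  have hFeq : (1 - X) * ((1 - v) * ((1 - X) ^ 2 - w * X ^ 2) - v * w * X) * F =
      X * (1 - v) * ((1 - X) ^ 2 - w * X ^ 2) - v ^ 2 * w * X * (1 - X) * h := by
    refine mul_left_cancel₀ (ne_zero_of (1 - X - w * X * h) (by simp)) ?_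
    linear_combination ((1 - v) * ((1 - X) ^ 2 - w * X ^ 2) - v * w * X) * hF +
      v * w * X * (1 - X) * hq
  have hfF : f - F = 0 := by
    refine eq_zero_of_kernel_equation (mul_left_cancel₀ (ne_zero_of (1 - X) (by simp)) ?_)
    rw [map_sub, hLF]
    linear_combination hf - hFeq
  rw [sub_eq_zero.mp hfF]
  exact hFeq

/-- The inclusion of `ℚ[v][w]⟦x⟧` into the power series in `x, v, w`. -/
noncomputable def toMvSeries : (Polynomial (Polynomial ℚ))⟦X⟧ →+ MvPowerSeries (Fin 3) ℚ where
  toFun p := fun d => ((coeff (d 0) p).coeff (d 2)).coeff (d 1)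
  map_zero' := by
    funext d
    simp only [map_zero, Polynomial.coeff_zero]
    rfl
  map_add' p q := by
    funext d
    simp only [map_add, Polynomial.coeff_add]
    rfl

theorem MvPowerSeries.coeff_X_mul_of_apply {σ R : Type*} [DecidableEq σ] [Semiring R] (s : σ)
    (p : MvPowerSeries σ R) (d : σ →₀ ℕ) :
    MvPowerSeries.coeff d (MvPowerSeries.X s * p) =
      if d s = 0 then 0 else MvPowerSeries.coeff (d - Finsupp.single s 1) p := by
  rw [MvPowerSeries.X, MvPowerSeries.coeff_monomial_mul]
  simp only [Finsupp.single_le_iff, one_mul, Nat.one_le_iff_ne_zero, ite_not]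

theorem coeff_toMvSeries (p : (Polynomial (Polynomial ℚ))⟦X⟧) (d : Fin 3 →₀ ℕ) :
    MvPowerSeries.coeff d (toMvSeries p) = ((coeff (d 0) p).coeff (d 2)).coeff (d 1) := rfl

theorem toMvSeries_X_mul (p : (Polynomial (Polynomial ℚ))⟦X⟧) :
    toMvSeries (X * p) = MvPowerSeries.X 0 * toMvSeries p := by
  ext d
  rw [MvPowerSeries.coeff_X_mul_of_apply, coeff_toMvSeries, coeff_toMvSeries]
  rcases hd : d 0 with _ | n <;> simp [hd, coeff_succ_X_mul]

theorem toMvSeries_v_mul (p : (Polynomial (Polynomial ℚ))⟦X⟧) :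
    toMvSeries (C (Polynomial.C Polynomial.X) * p) = MvPowerSeries.X 1 * toMvSeries p := by
  ext d
  rw [MvPowerSeries.coeff_X_mul_of_apply, coeff_toMvSeries, coeff_toMvSeries, coeff_C_mul,
    Polynomial.coeff_C_mul]
  rcases hd : d 1 with _ | n <;> simp [hd, Polynomial.coeff_X_mul]

theorem toMvSeries_w_mul (p : (Polynomial (Polynomial ℚ))⟦X⟧) :
    toMvSeries (C Polynomial.X * p) = MvPowerSeries.X 2 * toMvSeries p := by
  ext d
  rw [MvPowerSeries.coeff_X_mul_of_apply, coeff_toMvSeries, coeff_toMvSeries, coeff_C_mul]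
  rcases hd : d 2 with _ | n <;> simp [hd, Polynomial.coeff_X_mul]

theorem toMvSeries_one : toMvSeries 1 = 1 := by
  ext d
  rw [coeff_toMvSeries, MvPowerSeries.coeff_one, coeff_one]
  have hd : d = 0 ↔ d 0 = 0 ∧ d 2 = 0 ∧ d 1 = 0 := by
    rw [DFunLike.ext_iff, Fin.forall_fin_succ, Fin.forall_fin_two]
    simp
    tauto
  by_cases h0 : d 0 = 0 <;> by_cases h2 : d 2 = 0 <;> by_cases h1 : d 1 = 0 <;>
    simp [hd, h0, h1, h2, Polynomial.coeff_one]

theorem toMvSeries_wordSeries : toMvSeries (wordSeries wordWeight) = fSeries := by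
  ext d
  rw [coeff_toMvSeries]
  change _ = if 1 ≤ d 0 ∧ d 2 < d 0 ∧ d 1 ≤ d 2 then (cCount (d 0) (d 2) (d 1) : ℚ) else 0
  have hw (u : List ℕ) : ((wordWeight u).coeff (d 2)).coeff (d 1) =
      if maxLetter u = d 1 ∧ numAscents u = d 2 then 1 else 0 := by
    rw [wordWeight, ← Polynomial.C_pow, Polynomial.coeff_C_mul, Polynomial.coeff_X_pow]
    by_cases h1 : maxLetter u = d 1 <;> by_cases h2 : numAscents u = d 2 <;>
      simp [h1, h2, eq_comm, Polynomial.coeff_X_pow]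
  rw [wordSeries, coeff_mk, Polynomial.finsetSum_coeff, Polynomial.finsetSum_coeff]
  simp only [hw, Finset.sum_boole, ← cCount_eq_card]
  split_ifs with h
  · rfl
  · rw [cCount_eq_card, Finset.filter_eq_empty_iff.mpr, Finset.card_empty, Nat.cast_zero]
    rintro u hu ⟨h1, h2⟩
    have := words_invariants hu
    omega

theorem coeff_coeff_prodHom (p : Polynomial ℚ) (m r : ℕ) :
    ((prodHom p).coeff m).coeff r = if r = m then p.coeff m else 0 := by
  induction p using Polynomial.induction_on' with
  | add p q hp hq =>
    rw [map_add, Polynomial.coeff_add, Polynomial.coeff_add, hp, hq, Polynomial.coeff_add]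
    split_ifs <;> simp
  | monomial k c =>
    have : prodHom (Polynomial.monomial k c) =
        Polynomial.C (Polynomial.C c * Polynomial.X ^ k) * Polynomial.X ^ k := by
      simp [prodHom, mul_pow, mul_assoc]
    rw [this, Polynomial.coeff_C_mul_X_pow, Polynomial.coeff_monomial]
    by_cases h1 : m = k
    · subst h1
      simp [Polynomial.coeff_X_pow]
    · simp [h1, Ne.symm h1]

theorem toMvSeries_narayanaSeries : toMvSeries (map prodHom narayanaSeries) = hSeries := by
  ext d
  rw [coeff_toMvSeries, coeff_map, coeff_coeff_prodHom, narayanaSeries, coeff_mk,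
    coeff_narayanaPoly]
  change _ = if 1 ≤ d 0 ∧ d 2 < d 0 ∧ d 1 = d 2 then
    ((d 0).choose (d 2 + 1) * (d 0).choose (d 2) : ℚ) / (d 0) else 0
  by_cases h1 : d 1 = d 2
  · by_cases h2 : d 2 < d 0
    · rw [if_pos h1, if_pos ⟨by omega, h2, h1⟩, narayana]
    · rw [if_pos h1, if_neg (by tauto), narayana_eq_zero (by omega)]
  · rw [if_neg h1, if_neg (by tauto)]

end

open MvPowerSeries in
/-- The functional equation
`(1-x)((1-v)((1-x)² - wx²) - vwx) f = x(1-v)((1-x)² - wx²) - v²wx(1-x) h`. -/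
theorem fSeries_functional_equation :
    letI x : MvPowerSeries (Fin 3) ℚ := X 0
    letI v : MvPowerSeries (Fin 3) ℚ := X 1
    letI w : MvPowerSeries (Fin 3) ℚ := X 2
    (1 - x) * ((1 - v) * ((1 - x) ^ 2 - w * x ^ 2) - v * w * x) * fSeries =
      x * (1 - v) * ((1 - x) ^ 2 - w * x ^ 2) - v ^ 2 * w * x * (1 - x) * hSeries := by
  have key := congrArg toMvSeries wordSeries_functional_equation
  rw [← mul_one (_ * _ * (_ - _ * PowerSeries.X ^ 2))] at key
  simp only [sub_mul, mul_sub, one_mul, mul_assoc, pow_two, map_sub, toMvSeries_X_mul,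
    toMvSeries_v_mul, toMvSeries_w_mul, toMvSeries_one, toMvSeries_wordSeries,
    toMvSeries_narayanaSeries] at key
  linear_combination key
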